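/- arXiv:2301.06220 — 4 statements merged into one kernel-verified Lean document; each statement's English description precedes it below -/
import Mathlib

section
/- Let X be a Hausdorff topological space. Then |X| ≤ 2^{d(X)·wψc(X)} (cardinal exponentiation, with product of cardinals in the exponent). -/
open Set TopologicalSpace Cardinal

universe u

variable (X : Type u) [TopologicalSpace X]

/-- The density `d(X)`: the least infinite cardinal `κ` such that `X` has a dense
subset of cardinality at most `κ`. -/
noncomputable def density : Cardinal.{u} :=
  sInf {κ : Cardinal.{u} | ℵ₀ ≤ κ ∧ ∃ D : Set X, Dense D ∧ #D ≤ κ}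

/-- The cellularity `c(X)`: the least infinite cardinal `κ` such that every pairwise
disjoint family of nonempty open subsets of `X` has cardinality at most `κ`. -/
noncomputable def cellularity : Cardinal.{u} :=
  sInf {κ : Cardinal.{u} | ℵ₀ ≤ κ ∧ ∀ 𝒰 : Set (Set X),
    (∀ U ∈ 𝒰, IsOpen U ∧ U.Nonempty) → (𝒰.Pairwise fun U V => U ∩ V = ∅) → #𝒰 ≤ κ}

/-- The π-character of a point `x`: the least infinite cardinal `κ` such that `x`
has a local π-base of cardinality at most `κ`. -/
noncomputable def piCharAt (x : X) : Cardinal.{u} :=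
  sInf {κ : Cardinal.{u} | ℵ₀ ≤ κ ∧ ∃ ℬ : Set (Set X),
    (∀ B ∈ ℬ, IsOpen B ∧ B.Nonempty) ∧
    (∀ U : Set X, IsOpen U → x ∈ U → ∃ B ∈ ℬ, B ⊆ U) ∧ #ℬ ≤ κ}

/-- The π-character `πχ(X)`: the supremum over `x ∈ X` of `piCharAt X x`. -/
noncomputable def piChar : Cardinal.{u} := ⨆ x : X, piCharAt X x

/-- The π-weight `πw(X)`: the least infinite cardinal `κ` such that `X` has a π-base
of cardinality at most `κ`. -/
noncomputable def piWeight : Cardinal.{u} :=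
  sInf {κ : Cardinal.{u} | ℵ₀ ≤ κ ∧ ∃ ℬ : Set (Set X),
    (∀ B ∈ ℬ, IsOpen B ∧ B.Nonempty) ∧
    (∀ U : Set X, IsOpen U → U.Nonempty → ∃ B ∈ ℬ, B ⊆ U) ∧ #ℬ ≤ κ}

/-- The closed pseudocharacter `ψc(x, X)` of a point `x`: the least infinite cardinal
`κ` such that there is a family `𝒱` of open sets, each containing `x`, with `|𝒱| ≤ κ`
and `{x} = ⋂ 𝒱 = ⋂_{V ∈ 𝒱} cl V`. -/
noncomputable def closedPseudoCharAt (x : X) : Cardinal.{u} :=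
  sInf {κ : Cardinal.{u} | ℵ₀ ≤ κ ∧ ∃ 𝒱 : Set (Set X),
    (∀ V ∈ 𝒱, IsOpen V ∧ x ∈ V) ∧ #𝒱 ≤ κ ∧
    ({x} : Set X) = ⋂₀ 𝒱 ∧ ({x} : Set X) = ⋂ V ∈ 𝒱, closure V}

/-- The dense closed pseudocharacter `dψc(X)`: the least infinite cardinal `κ` such
that `X` has a dense subset `D` with `ψc(d, X) ≤ κ` for every `d ∈ D`. -/
noncomputable def densePsiC : Cardinal.{u} :=
  sInf {κ : Cardinal.{u} | ℵ₀ ≤ κ ∧ ∃ D : Set X, Dense D ∧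
    ∀ d ∈ D, closedPseudoCharAt X d ≤ κ}

/-- The weak closed pseudocharacter of a point `x`: the least infinite cardinal `κ`
such that there is a family `𝒱` of open sets (not necessarily containing `x`) with
`|𝒱| ≤ κ` and `{x} = ⋂_{V ∈ 𝒱} cl V`. -/
noncomputable def weakPsiCAt (x : X) : Cardinal.{u} :=
  sInf {κ : Cardinal.{u} | ℵ₀ ≤ κ ∧ ∃ 𝒱 : Set (Set X),
    (∀ V ∈ 𝒱, IsOpen V) ∧ (({x} : Set X) = ⋂ V ∈ 𝒱, closure V) ∧ #𝒱 ≤ κ}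

/-- The weak closed pseudocharacter `wψc(X)`: the supremum over `x ∈ X`. -/
noncomputable def weakPsiC : Cardinal.{u} := ⨆ x : X, weakPsiCAt X x

/-- The q-pseudocharacter of a point `x`: the least infinite cardinal `κ` such that
`x` has a q-pseudobase of cardinality at most `κ`, i.e. a family `ℬ` of nonempty open
sets such that for every `y ≠ x` there is `𝒞 ⊆ ℬ` with `x ∈ cl (⋃ 𝒞)` and
`y ∉ cl (⋃ 𝒞)`. -/
noncomputable def qPsiAt (x : X) : Cardinal.{u} :=
  sInf {κ : Cardinal.{u} | ℵ₀ ≤ κ ∧ ∃ ℬ : Set (Set X),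
    (∀ B ∈ ℬ, IsOpen B ∧ B.Nonempty) ∧ #ℬ ≤ κ ∧
    ∀ y : X, y ≠ x → ∃ 𝒞 ⊆ ℬ, x ∈ closure (⋃₀ 𝒞) ∧ y ∉ closure (⋃₀ 𝒞)}

/-- The q-pseudocharacter `qψ(X)`: the supremum over `x ∈ X`. -/
noncomputable def qPsi : Cardinal.{u} := ⨆ x : X, qPsiAt X x

/-- The o-tightness `ot(X)`: the least infinite cardinal `κ` such that whenever
`x ∈ cl (⋃ 𝒰)` for a family `𝒰` of open sets, there is `𝒱 ⊆ 𝒰` with `|𝒱| ≤ κ`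
and `x ∈ cl (⋃ 𝒱)`. -/
noncomputable def oTightness : Cardinal.{u} :=
  sInf {κ : Cardinal.{u} | ℵ₀ ≤ κ ∧ ∀ (x : X) (𝒰 : Set (Set X)),
    (∀ U ∈ 𝒰, IsOpen U) → x ∈ closure (⋃₀ 𝒰) →
    ∃ 𝒱 ⊆ 𝒰, #𝒱 ≤ κ ∧ x ∈ closure (⋃₀ 𝒱)}

/-- The dense o-tightness `dot(X)`: the least infinite cardinal `κ` such that whenever
`𝒰` is a family of open sets with `⋃ 𝒰` dense in `X` and `x ∈ X`, there is `𝒱 ⊆ 𝒰`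
with `|𝒱| ≤ κ` and `x ∈ cl (⋃ 𝒱)`. -/
noncomputable def denseOTightness : Cardinal.{u} :=
  sInf {κ : Cardinal.{u} | ℵ₀ ≤ κ ∧ ∀ (x : X) (𝒰 : Set (Set X)),
    (∀ U ∈ 𝒰, IsOpen U) → Dense (⋃₀ 𝒰) →
    ∃ 𝒱 ⊆ 𝒰, #𝒱 ≤ κ ∧ x ∈ closure (⋃₀ 𝒱)}

/-- A space is quasiregular if every nonempty open set contains the closure of some
nonempty open set. -/
def QuasiRegular : Prop :=
  ∀ U : Set X, IsOpen U → U.Nonempty → ∃ V : Set X, IsOpen V ∧ V.Nonempty ∧ closure V ⊆ U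

/-- The collection `RO(X)` of regular open subsets of `X`. -/
def regularOpens : Set (Set X) := {U : Set X | U = interior (closure U)}

theorem stmt_15 (X : Type u) [TopologicalSpace X] [T2Space X] :
    #X ≤ 2 ^ (density X * weakPsiC X) := by
  have hd : density X ∈ {κ : Cardinal.{u} | ℵ₀ ≤ κ ∧ ∃ D : Set X, Dense D ∧ #D ≤ κ} :=
    csInf_mem ⟨max ℵ₀ #(Set.univ : Set X), le_max_left _ _, Set.univ, dense_univ, le_max_right _ _⟩
  obtain ⟨hd0, D, hD, hDc⟩ := hd
  have hw : ∀ x : X, ∃ 𝒱 : Set (Set X), (∀ V ∈ 𝒱, IsOpen V) ∧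
      (({x} : Set X) = ⋂ V ∈ 𝒱, closure V) ∧ #𝒱 ≤ weakPsiC X := by
    intro x
    have hx : weakPsiCAt X x ∈ {κ : Cardinal.{u} | ℵ₀ ≤ κ ∧ ∃ 𝒱 : Set (Set X),
        (∀ V ∈ 𝒱, IsOpen V) ∧ (({x} : Set X) = ⋂ V ∈ 𝒱, closure V) ∧ #𝒱 ≤ κ} := by
      apply csInf_mem
      refine ⟨max ℵ₀ #({V : Set X | IsOpen V ∧ x ∈ V}), le_max_left _ _,
        {V : Set X | IsOpen V ∧ x ∈ V}, fun V hV => hV.1, ?_, le_max_right _ _⟩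
      apply Set.Subset.antisymm
      · intro y hy
        rw [Set.mem_singleton_iff] at hy
        subst hy
        exact Set.mem_iInter₂.2 fun V hV => subset_closure hV.2
      · intro y hy
        by_contra hne
        obtain ⟨U, V, hU, hV, hxU, hyV, hdisj⟩ := t2_separation (Ne.symm hne : x ≠ y)
        have h1 := Set.mem_iInter₂.1 hy U ⟨hU, hxU⟩
        obtain ⟨z, hz1, hz2⟩ := mem_closure_iff.1 h1 V hV hyV
        exact Set.disjoint_left.1 hdisj hz2 hz1
    obtain ⟨-, 𝒱, h1, h2, h3⟩ := hx
    exact ⟨𝒱, h1, h2, h3.trans (le_ciSup Cardinal.bddAbove_of_small x)⟩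
  choose 𝒱 hop heq hcard using hw
  let tr : Set X → Set D := fun V => Subtype.val ⁻¹' V
  let f : X → {t : Set (Set D) // #t ≤ weakPsiC X} :=
    fun x => ⟨tr '' 𝒱 x, mk_image_le.trans (hcard x)⟩
  have key : ∀ x : X, ({x} : Set X) = ⋂ W ∈ (f x).1, closure (Subtype.val '' W) := by
    intro x
    rw [heq x]
    simp only [f, tr, Set.biInter_image]
    refine Set.iInter₂_congr fun V hV => ?_
    rw [Subtype.image_preimage_coe, Set.inter_comm]
    exact Set.Subset.antisymm
      (closure_minimal (hD.open_subset_closure_inter (hop x V hV)) isClosed_closure)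
      (closure_mono Set.inter_subset_left)
  have hf : Function.Injective f := by
    intro x y hxy
    have := (key x).trans ((congrArg (fun t : {t : Set (Set D) // #t ≤ weakPsiC X} =>
      ⋂ W ∈ t.1, closure (Subtype.val '' W)) hxy).trans (key y).symm)
    exact Set.singleton_injective this
  calc #X ≤ #{t : Set (Set D) // #t ≤ weakPsiC X} := mk_le_of_injective hf
    _ ≤ max #(Set D) ℵ₀ ^ weakPsiC X := mk_bounded_set_le _ _
    _ ≤ (2 ^ density X) ^ weakPsiC X := by
      apply Cardinal.power_le_power_right
      apply max_le
      · rw [mk_set]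
        exact Cardinal.power_le_power_left two_ne_zero hDc
      · exact hd0.trans (cantor _).le
    _ = 2 ^ (density X * weakPsiC X) := (power_mul).symm
end

section
/- Let X be a Hausdorff topological space. Then |X| ≤ 2^{πw(X)^{dot(X)}} (iterated cardinal exponentiation). -/
open Set TopologicalSpace Cardinal

universe u

variable (X : Type u) [TopologicalSpace X]

theorem piWeight_spec (X : Type u) [TopologicalSpace X] : ∃ ℬ : Set (Set X),
    (∀ B ∈ ℬ, IsOpen B ∧ B.Nonempty) ∧
    (∀ U : Set X, IsOpen U → U.Nonempty → ∃ B ∈ ℬ, B ⊆ U) ∧ #ℬ ≤ piWeight X := by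
  have h : piWeight X ∈ {κ : Cardinal.{u} | ℵ₀ ≤ κ ∧ ∃ ℬ : Set (Set X),
    (∀ B ∈ ℬ, IsOpen B ∧ B.Nonempty) ∧
    (∀ U : Set X, IsOpen U → U.Nonempty → ∃ B ∈ ℬ, B ⊆ U) ∧ #ℬ ≤ κ} := by
    apply csInf_mem
    exact ⟨max ℵ₀ #({B : Set X | IsOpen B ∧ B.Nonempty}), le_max_left _ _,
      {B : Set X | IsOpen B ∧ B.Nonempty}, fun B hB => hB,
      fun U h1 h2 => ⟨U, ⟨h1, h2⟩, subset_rfl⟩, le_max_right _ _⟩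
  exact h.2

theorem denseOTightness_spec (X : Type u) [TopologicalSpace X] :
    ∀ (x : X) (𝒰 : Set (Set X)),
    (∀ U ∈ 𝒰, IsOpen U) → Dense (⋃₀ 𝒰) →
    ∃ 𝒱 ⊆ 𝒰, #𝒱 ≤ denseOTightness X ∧ x ∈ closure (⋃₀ 𝒱) := by
  have h : denseOTightness X ∈ {κ : Cardinal.{u} | ℵ₀ ≤ κ ∧ ∀ (x : X) (𝒰 : Set (Set X)),
    (∀ U ∈ 𝒰, IsOpen U) → Dense (⋃₀ 𝒰) →
    ∃ 𝒱 ⊆ 𝒰, #𝒱 ≤ κ ∧ x ∈ closure (⋃₀ 𝒱)} := by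
    apply csInf_mem
    exact ⟨max ℵ₀ #(Set X), le_max_left _ _, fun x 𝒰 _ h2 =>
      ⟨𝒰, subset_rfl, (mk_set_le 𝒰).trans (le_max_right _ _), h2 x⟩⟩
  exact h.2

theorem stmt_16 (X : Type u) [TopologicalSpace X] [T2Space X] :
    #X ≤ 2 ^ (piWeight X ^ denseOTightness X) := by
  obtain ⟨ℬ, hB, hpi, hcard⟩ := piWeight_spec X
  have hdot := denseOTightness_spec X
  set κ := denseOTightness X
  have key : ∀ x y : X, x ≠ y → ∃ f : κ.out → ℬ,
      x ∈ closure (⋃ i, (f i : Set X)) ∧ y ∉ closure (⋃ i, (f i : Set X)) := by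
    intro x y hxy
    obtain ⟨U, W, hU, hW, hxU, hyW, hd⟩ := t2_separation hxy
    obtain ⟨𝒱, hV, hVc, hxV⟩ := hdot x {B | B ∈ ℬ ∧ (B ⊆ U ∨ Disjoint B U)}
      (fun B h => (hB B h.1).1) (by
        intro z
        rw [mem_closure_iff]
        intro O hO hzO
        by_cases hne : (O ∩ U).Nonempty
        · obtain ⟨B, hBB, hs⟩ := hpi _ (hO.inter hU) hne
          obtain ⟨b, hb⟩ := (hB B hBB).2
          exact ⟨b, (hs hb).1, B, ⟨hBB, Or.inl fun t ht => (hs ht).2⟩, hb⟩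
        · obtain ⟨B, hBB, hs⟩ := hpi _ hO ⟨z, hzO⟩
          obtain ⟨b, hb⟩ := (hB B hBB).2
          refine ⟨b, hs hb, B, ⟨hBB, Or.inr ?_⟩, hb⟩
          rw [Set.disjoint_left]
          exact fun t ht htU => hne ⟨t, hs ht, htU⟩)
    let 𝒲 : Set ℬ := {B | (B : Set X) ∈ 𝒱 ∧ (B : Set X) ⊆ U}
    have hx : ∀ O : Set X, IsOpen O → x ∈ O → ∃ B ∈ 𝒲, ∃ b ∈ O, b ∈ (B : Set X) := by
      intro O hO hxO
      obtain ⟨b, ⟨hbO, hbU⟩, B, hBV, hb⟩ :=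
        mem_closure_iff.1 hxV (O ∩ U) (hO.inter hU) ⟨hxO, hxU⟩
      refine ⟨⟨B, (hV hBV).1⟩, ⟨hBV, ?_⟩, b, hbO, hb⟩
      rcases (hV hBV).2 with h | h
      · exact h
      · exact (Set.disjoint_left.1 h hb hbU).elim
    obtain ⟨B₀, hB₀, -⟩ := hx univ isOpen_univ trivial
    have hWc : #𝒲 ≤ #κ.out := by
      rw [mk_out]
      refine le_trans ?_ hVc
      refine mk_le_of_injective (f := fun B : 𝒲 => (⟨B.1.1, B.2.1⟩ : 𝒱)) ?_
      intro a b hab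
      exact Subtype.ext (Subtype.ext (Subtype.mk.inj hab))
    obtain ⟨e⟩ := hWc
    haveI : Nonempty 𝒲 := ⟨⟨B₀, hB₀⟩⟩
    have hs : Function.Surjective (Function.invFun e) := Function.invFun_surjective e.injective
    refine ⟨fun i => (Function.invFun e i).1, ?_, ?_⟩
    · rw [mem_closure_iff]
      intro O hO hxO
      obtain ⟨B, hBW, b, hbO, hb⟩ := hx O hO hxO
      obtain ⟨i, hi⟩ := hs ⟨B, hBW⟩
      refine ⟨b, hbO, mem_iUnion.2 ⟨i, ?_⟩⟩
      have h4 : b ∈ ((Function.invFun e i).1 : Set X) := by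
        rw [hi]
        exact hb
      exact h4
    · intro hy
      obtain ⟨b, hbW, hb⟩ := mem_closure_iff.1 hy W hW hyW
      obtain ⟨i, hi⟩ := mem_iUnion.1 hb
      exact Set.disjoint_left.1 hd ((Function.invFun e i).2.2 hi) hbW
  have hinj : Function.Injective
      (fun x : X => {f : κ.out → ℬ | x ∈ closure (⋃ i, (f i : Set X))}) := by
    intro x y hxy
    by_contra hne
    obtain ⟨f, h1, h2⟩ := key x y hne
    have h3 : f ∈ {f : κ.out → ℬ | y ∈ closure (⋃ i, (f i : Set X))} :=
      (Set.ext_iff.1 hxy f).1 h1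
    exact h2 h3
  calc #X ≤ #(Set (κ.out → ℬ)) := mk_le_of_injective hinj
    _ = 2 ^ (#ℬ ^ κ) := by rw [mk_set, ← power_def, mk_out]
    _ ≤ 2 ^ (piWeight X ^ κ) :=
      power_le_power_left two_ne_zero (power_le_power_right hcard)
end

section
/- Let X be a Hausdorff topological space. Then |X| ≤ 2^{d(X)^{πχ(X)}} (iterated cardinal exponentiation). -/
open Set TopologicalSpace Cardinal

universe u

variable (X : Type u) [TopologicalSpace X]

theorem stmt_17 (X : Type u) [TopologicalSpace X] [T2Space X] :
    #X ≤ 2 ^ (density X ^ piChar X) := by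
  obtain ⟨hd0, D, hD, hDc⟩ : density X ∈ {κ : Cardinal.{u} | ℵ₀ ≤ κ ∧
      ∃ D : Set X, Dense D ∧ #D ≤ κ} := by
    apply csInf_mem
    exact ⟨max ℵ₀ #(univ : Set X), le_max_left _ _, univ, dense_univ, le_max_right _ _⟩
  have hpi : ∀ x : X, ∃ ℬ : Set (Set X),
      (∀ B ∈ ℬ, IsOpen B ∧ B.Nonempty) ∧
      (∀ U : Set X, IsOpen U → x ∈ U → ∃ B ∈ ℬ, B ⊆ U) ∧ #ℬ ≤ piChar X := by
    intro x
    obtain ⟨_, ℬ, h1, h2, h3⟩ : piCharAt X x ∈ {κ : Cardinal.{u} | ℵ₀ ≤ κ ∧ ∃ ℬ : Set (Set X),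
        (∀ B ∈ ℬ, IsOpen B ∧ B.Nonempty) ∧
        (∀ U : Set X, IsOpen U → x ∈ U → ∃ B ∈ ℬ, B ⊆ U) ∧ #ℬ ≤ κ} := by
      apply csInf_mem
      refine ⟨max ℵ₀ #({B : Set X | IsOpen B ∧ B.Nonempty} : Set (Set X)), le_max_left _ _,
        {B : Set X | IsOpen B ∧ B.Nonempty}, fun B hB => hB, ?_, le_max_right _ _⟩
      intro U hU hx
      exact ⟨U, ⟨hU, ⟨x, hx⟩⟩, subset_rfl⟩
    refine ⟨ℬ, h1, h2, h3.trans ?_⟩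
    exact le_ciSup (f := fun x => piCharAt X x) Cardinal.bddAbove_of_small x
  let K : Type u := (piChar X).out
  have hK : #K = piChar X := Cardinal.mk_out _
  have key : ∀ x : X, ∀ U : Set X, IsOpen U → x ∈ U →
      ∃ f : K → D, x ∈ closure (range fun k => (f k : X)) ∧ ∀ k, (f k : X) ∈ U := by
    intro x U hU hx
    obtain ⟨ℬ, h1, h2, h3⟩ := hpi x
    let S : Set (Set X) := {B ∈ ℬ | B ⊆ U}
    have hS : S.Nonempty := by
      obtain ⟨B, hB, hBU⟩ := h2 U hU hx
      exact ⟨B, hB, hBU⟩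
    have : Nonempty S := hS.to_subtype
    have hSK : #S ≤ #K := by
      rw [hK]; exact (Cardinal.mk_le_mk_of_subset (fun B hB => hB.1)).trans h3
    obtain ⟨e⟩ := hSK
    have hp : ∀ B : S, ∃ p : D, (p : X) ∈ (B : Set X) := by
      rintro ⟨B, hB, hBU⟩
      obtain ⟨p, hp, hpD⟩ := hD.inter_open_nonempty B (h1 B hB).1 (h1 B hB).2
      exact ⟨⟨p, hpD⟩, hp⟩
    choose p hp using hp
    refine ⟨fun k => p (Function.invFun e k), ?_, fun k => (Function.invFun e k).2.2 (hp _)⟩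
    rw [mem_closure_iff]
    intro V hV hxV
    obtain ⟨B, hB, hBV⟩ := h2 (U ∩ V) (hU.inter hV) ⟨hx, hxV⟩
    let b : S := ⟨B, hB, fun z hz => (hBV hz).1⟩
    refine ⟨p b, (hBV (hp b)).2, e b, ?_⟩
    simp only [Function.leftInverse_invFun e.injective b]
  have hinj : Function.Injective
      (fun x : X => {f : K → D | x ∈ closure (range fun k => (f k : X))}) := by
    intro x y hxy
    by_contra hne
    obtain ⟨U, V, hU, hV, hxU, hyV, hUV⟩ := t2_separation hne
    obtain ⟨f, hf, hfU⟩ := key x U hU hxU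
    have hfy : f ∈ {f : K → D | y ∈ closure (range fun k => (f k : X))} := by
      exact (Set.ext_iff.1 hxy f).1 hf
    obtain ⟨z, hzV, k, rfl⟩ := mem_closure_iff.1 hfy V hV hyV
    exact Set.disjoint_left.1 hUV (hfU k) hzV
  calc #X ≤ #(Set (K → D)) := Cardinal.mk_le_of_injective hinj
    _ = 2 ^ (#D ^ piChar X) := by rw [Cardinal.mk_set, ← hK]; simp
    _ ≤ 2 ^ (density X ^ piChar X) :=
      Cardinal.power_le_power_left two_ne_zero (Cardinal.power_le_power_right hDc)
end

section
/- Let X be a Hausdorff topological space. Then |X| ≤ d(X)^{πχ(X)^{ot(X)}} (iterated cardinal exponentiation). -/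
open Set TopologicalSpace Cardinal

universe u

variable (X : Type u) [TopologicalSpace X]

theorem aux_density : ℵ₀ ≤ density X ∧ ∃ D : Set X, Dense D ∧ #D ≤ density X := by
  have h : (density X) ∈ {κ : Cardinal.{u} | ℵ₀ ≤ κ ∧ ∃ D : Set X, Dense D ∧ #D ≤ κ} := by
    apply csInf_mem
    exact ⟨max ℵ₀ #(univ : Set X), le_max_left _ _, univ, dense_univ, le_max_right _ _⟩
  exact h

theorem aux_pi (x : X) : ℵ₀ ≤ piChar X ∧ ∃ ℬ : Set (Set X),
    (∀ B ∈ ℬ, IsOpen B ∧ B.Nonempty) ∧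
    (∀ U : Set X, IsOpen U → x ∈ U → ∃ B ∈ ℬ, B ⊆ U) ∧ #ℬ ≤ piChar X := by
  have h : (piCharAt X x) ∈ {κ : Cardinal.{u} | ℵ₀ ≤ κ ∧ ∃ ℬ : Set (Set X),
    (∀ B ∈ ℬ, IsOpen B ∧ B.Nonempty) ∧
    (∀ U : Set X, IsOpen U → x ∈ U → ∃ B ∈ ℬ, B ⊆ U) ∧ #ℬ ≤ κ} := by
    apply csInf_mem
    exact ⟨max ℵ₀ #({B : Set X | IsOpen B ∧ B.Nonempty} : Set (Set X)), le_max_left _ _,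
      _, fun B hB => hB, fun U hU hx => ⟨U, ⟨hU, x, hx⟩, Subset.rfl⟩, le_max_right _ _⟩
  have h2 : piCharAt X x ≤ piChar X := le_ciSup (f := piCharAt X) (bddAbove_of_small) x
  obtain ⟨h3, ℬ, h4, h5, h6⟩ := h
  exact ⟨h3.trans h2, ℬ, h4, h5, h6.trans h2⟩

theorem aux_ot : ℵ₀ ≤ oTightness X ∧ ∀ (x : X) (𝒰 : Set (Set X)),
    (∀ U ∈ 𝒰, IsOpen U) → x ∈ closure (⋃₀ 𝒰) →
    ∃ 𝒱 ⊆ 𝒰, #𝒱 ≤ oTightness X ∧ x ∈ closure (⋃₀ 𝒱) := by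
  have h : (oTightness X) ∈ {κ : Cardinal.{u} | ℵ₀ ≤ κ ∧ ∀ (x : X) (𝒰 : Set (Set X)),
    (∀ U ∈ 𝒰, IsOpen U) → x ∈ closure (⋃₀ 𝒰) →
    ∃ 𝒱 ⊆ 𝒰, #𝒱 ≤ κ ∧ x ∈ closure (⋃₀ 𝒱)} := by
    apply csInf_mem
    exact ⟨max ℵ₀ #(Set X), le_max_left _ _, fun x 𝒰 _ hx =>
      ⟨𝒰, Subset.rfl, (mk_set_le 𝒰).trans (le_max_right _ _), hx⟩⟩
  exact h

theorem aux_enum {α : Type u} (S : Set α) (hS : S.Nonempty) (κ : Cardinal.{u}) (h : #S ≤ κ) :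
    ∃ f : κ.out → α, range f = S := by
  have : Nonempty S := hS.to_subtype
  rw [← mk_out κ] at h
  obtain ⟨e⟩ := h
  refine ⟨fun i => (Function.invFun e i : S), ?_⟩
  rw [range_comp' Subtype.val (Function.invFun e),
    (Function.invFun_surjective e.injective).range_eq, image_univ, Subtype.range_val]

theorem stmt_19 (X : Type u) [TopologicalSpace X] [T2Space X] :
    #X ≤ density X ^ (piChar X ^ oTightness X) := by
  rcases isEmpty_or_nonempty X with hX | ⟨⟨x₀⟩⟩
  · simp
  obtain ⟨hd, D, hD, hDc⟩ := aux_density X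
  obtain ⟨ho, hot⟩ := aux_ot X
  have hp := (aux_pi X x₀).1
  -- local π-bases
  have h1 : ∀ x : X, ∃ b : (piChar X).out → Set X, (∀ i, IsOpen (b i) ∧ (b i).Nonempty) ∧
      ∀ U : Set X, IsOpen U → x ∈ U → ∃ i, b i ⊆ U := by
    intro x
    obtain ⟨-, ℬ, h4, h5, h6⟩ := aux_pi X x
    obtain ⟨B, hB, -⟩ := h5 univ isOpen_univ trivial
    obtain ⟨f, hf⟩ := aux_enum ℬ ⟨B, hB⟩ _ h6
    refine ⟨f, fun i => h4 _ (hf ▸ mem_range_self i), fun U hU hx => ?_⟩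
    obtain ⟨B, hB, hBU⟩ := h5 U hU hx
    rw [← hf] at hB
    obtain ⟨i, rfl⟩ := hB
    exact ⟨i, hBU⟩
  choose b hb hb2 using h1
  have h2 : ∀ (x : X) (i : (piChar X).out), ∃ p : D × (piChar X).out, b p.1 p.2 ⊆ b x i := by
    intro x i
    obtain ⟨y, hy, hyD⟩ := hD.inter_open_nonempty _ (hb x i).1 (hb x i).2
    obtain ⟨j, hj⟩ := hb2 y _ (hb x i).1 hy
    exact ⟨(⟨y, hyD⟩, j), hj⟩
  choose g hg using h2
  let c : (D × (piChar X).out) → Set X := fun p => b p.1 p.2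
  let A : X → Set ((oTightness X).out → (piChar X).out) :=
    fun x => {f | x ∈ closure (⋃ o, c (g x (f o)))}
  have inj : Function.Injective (fun x => (g x, A x)) := by
    intro x y hxy
    obtain ⟨hgxy, hA⟩ := Prod.mk.inj hxy
    by_contra hne
    obtain ⟨U, V, hU, hV, hxU, hyV, hUV⟩ := t2_separation hne
    have hx : x ∈ closure (⋃₀ (c ∘ g x '' {i | c (g x i) ⊆ U})) := by
      rw [mem_closure_iff]
      intro W hW hxW
      obtain ⟨i, hi⟩ := hb2 x (U ∩ W) (hU.inter hW) ⟨hxU, hxW⟩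
      obtain ⟨z, hz⟩ := (hb (g x i).1 (g x i).2).2
      have hz2 := hi (hg x i hz)
      exact ⟨z, hz2.2, c (g x i), ⟨i, (hg x i).trans (hi.trans inter_subset_left), rfl⟩, hz⟩
    obtain ⟨𝒱, hV1, hV2, hV3⟩ := hot x _ (by
      rintro _ ⟨i, -, rfl⟩
      exact (hb _ _).1) hx
    have hne : 𝒱.Nonempty := by
      by_contra h
      rw [not_nonempty_iff_eq_empty] at h
      simp [h] at hV3
    obtain ⟨f, hf⟩ := aux_enum 𝒱 hne _ hV2
    have h3 : ∀ o, ∃ i, c (g x i) ⊆ U ∧ c (g x i) = f o := fun o => by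
      obtain ⟨i, h, h'⟩ := hV1 (hf ▸ mem_range_self o)
      exact ⟨i, h, h'⟩
    choose k hk hk2 using h3
    have hkx : k ∈ A x := by
      change x ∈ closure (⋃ o, c (g x (k o)))
      simp only [hk2]
      rwa [← sUnion_range, hf]
    rw [hA] at hkx
    change y ∈ closure (⋃ o, c (g y (k o))) at hkx
    rw [← hgxy, mem_closure_iff] at hkx
    obtain ⟨z, hzV, hz⟩ := hkx V hV hyV
    obtain ⟨o, ho⟩ := mem_iUnion.1 hz
    exact hUV.le_bot ⟨hk o ho, hzV⟩
  have hle := mk_le_of_injective inj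
  refine hle.trans ?_
  have e : #(((piChar X).out → D × (piChar X).out) ×
      Set ((oTightness X).out → (piChar X).out)) =
      (#D * piChar X) ^ piChar X * 2 ^ (piChar X ^ oTightness X) := by
    simp
  rw [e]
  have hpp : piChar X ≤ piChar X ^ oTightness X :=
    self_le_power _ (one_le_aleph0.trans ho)
  have hd0 : density X ≠ 0 := (aleph0_pos.trans_le hd).ne'
  have h2d : (2 : Cardinal) ≤ density X := (ofNat_lt_aleph0 (n := 2)).le.trans hd
  have hinf : ℵ₀ ≤ density X ^ (piChar X ^ oTightness X) :=
    hd.trans (self_le_power _ ((one_le_aleph0.trans hp).trans hpp))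
  refine mul_le_of_le hinf ?_ (power_le_power_right h2d)
  rw [mul_power]
  refine mul_le_of_le hinf ?_ ?_
  · exact (power_le_power_right hDc).trans (power_le_power_left hd0 hpp)
  · rw [power_self_eq hp]
    exact (power_le_power_right h2d).trans (power_le_power_left hd0 hpp)
end
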